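/- For any 𝐦 ∈ ℤ_{≥0}^{n−1}, the polytope X_{𝐦,0} coincides with the FFLV polytope X_𝐦, i.e. a point x ∈ ℝ_{≥0}^{P} satisfies Σ_{α∈P'} x_α ≤ Σ_{d=1}^{n−1} m_d·w(P'∩P_d) for every subset P' ⊆ P if and only if for every nonempty chain C ⊆ P one has Σ_{α∈C} x_α ≤ m_{s(C)} + m_{s(C)+1} + … + m_{f(C)−1}. -/

import Mathlib

/-- The poset `P` of pairs `(i,j)` with `1 ≤ j < i ≤ n` (componentwise order). -/
def posetP (n : ℕ) : Finset (ℕ × ℕ) :=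
  (Finset.range (n + 1) ×ˢ Finset.range (n + 1)).filter
    (fun p => 1 ≤ p.2 ∧ p.2 < p.1 ∧ p.1 ≤ n)

/-- The subposet `P_d = {(i,j) ∈ P : i > d ≥ j}`. -/
def posetPd (n d : ℕ) : Finset (ℕ × ℕ) :=
  (posetP n).filter (fun p => d < p.1 ∧ p.2 ≤ d)

/-- The width of a finite subset of `ℕ × ℕ` (with the componentwise order):
the maximal cardinality of an antichain contained in it. -/
noncomputable def finWidth (Q : Finset (ℕ × ℕ)) : ℕ :=
  sSup (Finset.card '' {A : Finset (ℕ × ℕ) |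
    A ⊆ Q ∧ IsAntichain (· ≤ ·) (A : Set (ℕ × ℕ))})

/-- `s(C)`: the second coordinate of the minimal element of a (nonempty) chain `C`. -/
noncomputable def chainS (C : Finset (ℕ × ℕ)) : ℕ :=
  sInf (Prod.snd '' (C : Set (ℕ × ℕ)))

/-- `f(C)`: the first coordinate of the maximal element of a (nonempty) chain `C`. -/
noncomputable def chainF (C : Finset (ℕ × ℕ)) : ℕ :=
  sSup (Prod.fst '' (C : Set (ℕ × ℕ)))

theorem bddAbove_antichain_card (Q : Finset (ℕ × ℕ)) :
    BddAbove (Finset.card '' {A : Finset (ℕ × ℕ) |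
      A ⊆ Q ∧ IsAntichain (· ≤ ·) (A : Set (ℕ × ℕ))}) :=
  ⟨Q.card, by rintro _ ⟨A, hA, rfl⟩; exact Finset.card_le_card hA.1⟩

theorem card_le_finWidth {A Q : Finset (ℕ × ℕ)} (hAQ : A ⊆ Q)
    (hA : IsAntichain (· ≤ ·) (A : Set (ℕ × ℕ))) : A.card ≤ finWidth Q :=
  le_csSup (bddAbove_antichain_card Q) ⟨A, ⟨hAQ, hA⟩, rfl⟩

theorem exists_antichain_card_eq_finWidth (Q : Finset (ℕ × ℕ)) :
    ∃ A ⊆ Q, IsAntichain (· ≤ ·) (A : Set (ℕ × ℕ)) ∧ A.card = finWidth Q := by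
  have hne : (Finset.card '' {A : Finset (ℕ × ℕ) |
      A ⊆ Q ∧ IsAntichain (· ≤ ·) (A : Set (ℕ × ℕ))}).Nonempty :=
    ⟨_, ∅, ⟨Finset.empty_subset Q, by simp⟩, rfl⟩
  obtain ⟨A, ⟨hAQ, hA⟩, hcard⟩ := Nat.sSup_mem hne (bddAbove_antichain_card Q)
  exact ⟨A, hAQ, hA, hcard⟩

theorem finWidth_mono {Q R : Finset (ℕ × ℕ)} (h : Q ⊆ R) : finWidth Q ≤ finWidth R := by
  obtain ⟨A, hAQ, hA, hcard⟩ := exists_antichain_card_eq_finWidth Q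
  exact hcard ▸ card_le_finWidth (hAQ.trans h) hA

theorem finWidth_pos {Q : Finset (ℕ × ℕ)} (h : Q.Nonempty) : 1 ≤ finWidth Q := by
  obtain ⟨a, ha⟩ := h
  have := card_le_finWidth (A := {a}) (Finset.singleton_subset_iff.2 ha) (by simp)
  simpa using this

theorem finWidth_empty : finWidth ∅ = 0 := by
  obtain ⟨A, hA, -, hcard⟩ := exists_antichain_card_eq_finWidth ∅
  rw [← hcard, Finset.subset_empty.1 hA, Finset.card_empty]

theorem finWidth_le_one_of_isChain {Q : Finset (ℕ × ℕ)}
    (hQ : IsChain (· ≤ ·) (Q : Set (ℕ × ℕ))) : finWidth Q ≤ 1 := by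
  obtain ⟨A, hAQ, hA, hcard⟩ := exists_antichain_card_eq_finWidth Q
  rw [← hcard, Finset.card_le_one]
  intro a ha b hb
  rcases hQ.total (hAQ ha) (hAQ hb) with h | h
  · exact hA.eq ha hb h
  · exact (hA.eq hb ha h).symm

theorem mem_posetP {n : ℕ} {a : ℕ × ℕ} : a ∈ posetP n ↔ 1 ≤ a.2 ∧ a.2 < a.1 ∧ a.1 ≤ n := by
  simp only [posetP, Finset.mem_filter, Finset.mem_product, Finset.mem_range]
  omega

theorem mem_posetPd {n d : ℕ} {a : ℕ × ℕ} :
    a ∈ posetPd n d ↔ a ∈ posetP n ∧ d < a.1 ∧ a.2 ≤ d := by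
  simp [posetPd]

theorem chainS_le {C : Finset (ℕ × ℕ)} {a : ℕ × ℕ} (ha : a ∈ C) : chainS C ≤ a.2 :=
  Nat.sInf_le ⟨a, ha, rfl⟩

theorem le_chainF {C : Finset (ℕ × ℕ)} {a : ℕ × ℕ} (ha : a ∈ C) : a.1 ≤ chainF C :=
  le_csSup (C.finite_toSet.image _).bddAbove ⟨a, ha, rfl⟩

theorem exists_snd_eq_chainS {C : Finset (ℕ × ℕ)} (hC : C.Nonempty) :
    ∃ a ∈ C, a.2 = chainS C :=
  Nat.sInf_mem (s := Prod.snd '' (C : Set (ℕ × ℕ))) (hC.to_set.image _)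

theorem exists_fst_eq_chainF {C : Finset (ℕ × ℕ)} (hC : C.Nonempty) :
    ∃ a ∈ C, a.1 = chainF C :=
  Nat.sSup_mem (s := Prod.fst '' (C : Set (ℕ × ℕ))) (hC.to_set.image _)
    (C.finite_toSet.image _).bddAbove

/-- The chain inequalities self-improve: only those `d` for which the chain meets `P_d`
are needed on the right-hand side. -/
theorem sum_chain_le_sum_filter_inter_nonempty {n : ℕ} {m : ℕ → ℕ} {x : ℕ × ℕ → ℝ}
    (h : ∀ C ⊆ posetP n, C.Nonempty → IsChain (· ≤ ·) (C : Set (ℕ × ℕ)) →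
      ∑ α ∈ C, x α ≤ ∑ d ∈ Finset.Ico (chainS C) (chainF C), (m d : ℝ))
    (C : Finset (ℕ × ℕ)) (hCP : C ⊆ posetP n) (hC : IsChain (· ≤ ·) (C : Set (ℕ × ℕ))) :
    ∑ α ∈ C, x α ≤
      ∑ d ∈ Finset.Icc 1 (n - 1) with (C ∩ posetPd n d).Nonempty, (m d : ℝ) := by
  induction C using Finset.strongInduction with
  | H C ih =>
    rcases C.eq_empty_or_nonempty with rfl | hne
    · simp
    obtain ⟨a, ha, has⟩ := exists_snd_eq_chainS hne
    obtain ⟨b, hb, hbf⟩ := exists_fst_eq_chainF hne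
    by_cases hgap : ∀ d ∈ Finset.Ico (chainS C) (chainF C), (C ∩ posetPd n d).Nonempty
    · refine (h C hCP hne hC).trans (Finset.sum_le_sum_of_subset_of_nonneg ?_ ?_)
      · intro d hd
        have h1 := mem_posetP.1 (hCP ha)
        have h2 := mem_posetP.1 (hCP hb)
        refine Finset.mem_filter.2 ⟨?_, hgap d hd⟩
        rw [Finset.mem_Ico] at hd
        rw [Finset.mem_Icc]
        omega
      · intros
        positivity
    push Not at hgap
    obtain ⟨d, hd, hdC⟩ := hgap
    rw [Finset.mem_Ico] at hd
    have hmiss : ∀ c ∈ C, ¬ c.1 ≤ d → d < c.2 := by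
      intro c hc hcd
      by_contra hcd'
      have : c ∈ C ∩ posetPd n d :=
        Finset.mem_inter.2 ⟨hc, mem_posetPd.2 ⟨hCP hc, by omega, by omega⟩⟩
      simp [hdC] at this
    have hlow := ih (C.filter (·.1 ≤ d))
      (Finset.filter_ssubset.2 ⟨b, hb, by omega⟩)
      ((Finset.filter_subset _ _).trans hCP)
      (hC.mono (Finset.coe_subset.2 (Finset.filter_subset _ _)))
    have hhigh := ih (C.filter (¬ ·.1 ≤ d))
      (Finset.filter_ssubset.2 ⟨a, ha, fun hn => by have := hmiss a ha hn; omega⟩)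
      ((Finset.filter_subset _ _).trans hCP)
      (hC.mono (Finset.coe_subset.2 (Finset.filter_subset _ _)))
    rw [← Finset.sum_filter_add_sum_filter_not C (·.1 ≤ d)]
    refine (add_le_add hlow hhigh).trans ?_
    rw [← Finset.sum_union]
    · refine Finset.sum_le_sum_of_subset_of_nonneg ?_ (fun _ _ _ => by positivity)
      refine Finset.union_subset ?_ ?_ <;>
      · intro e he
        rw [Finset.mem_filter] at he ⊢
        exact ⟨he.1, he.2.mono (Finset.inter_subset_inter_right (Finset.filter_subset _ _))⟩
    · rw [Finset.disjoint_left]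
      intro e he he'
      obtain ⟨u, hu⟩ := (Finset.mem_filter.1 he).2
      obtain ⟨v, hv⟩ := (Finset.mem_filter.1 he').2
      simp only [Finset.mem_inter, Finset.mem_filter, mem_posetPd] at hu hv
      have := hmiss v hv.1.1 hv.1.2
      omega

/-- The nesting depth of `a` in `Q`, where `(i,j)` is viewed as the interval `[j,i)`:
the width of the set of intervals in `Q` containing that of `a`. -/
noncomputable def nestingDepth (Q : Finset (ℕ × ℕ)) (a : ℕ × ℕ) : ℕ :=
  finWidth (Q.filter fun b => a.1 ≤ b.1 ∧ b.2 ≤ a.2)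

theorem nestingDepth_lt {Q : Finset (ℕ × ℕ)} {a b : ℕ × ℕ} (ha : a ∈ Q)
    (h1 : a.1 < b.1) (h2 : b.2 < a.2) : nestingDepth Q b < nestingDepth Q a := by
  obtain ⟨A, hAQ, hA, hcard⟩ :=
    exists_antichain_card_eq_finWidth (Q.filter fun c => b.1 ≤ c.1 ∧ c.2 ≤ b.2)
  have hmem : ∀ c ∈ A, c ∈ Q ∧ b.1 ≤ c.1 ∧ c.2 ≤ b.2 := fun c hc => by
    simpa using hAQ hc
  have haA : a ∉ A := fun h => by
    have := hmem a h
    omega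
  rw [nestingDepth, ← hcard, ← Nat.succ_le_iff, Nat.succ_eq_add_one,
    ← Finset.card_insert_of_notMem haA]
  refine card_le_finWidth ?_ ?_
  · intro c hc
    rcases Finset.mem_insert.1 hc with rfl | hc
    · simpa using ha
    · obtain ⟨hcQ, hc1, hc2⟩ := hmem c hc
      exact Finset.mem_filter.2 ⟨hcQ, by omega, by omega⟩
  · rw [Finset.coe_insert]
    refine hA.insert (fun c hc _ hle => ?_) (fun c hc _ hle => ?_) <;>
    · have := hmem c hc
      have := Prod.le_def.1 hle
      omega

theorem isChain_nestingDepth_eq (Q : Finset (ℕ × ℕ)) (r : ℕ) :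
    IsChain (· ≤ ·) ((Q.filter (nestingDepth Q · = r) : Finset (ℕ × ℕ)) : Set (ℕ × ℕ)) := by
  intro a ha b hb _
  obtain ⟨haQ, rfl⟩ := Finset.mem_filter.1 (Finset.mem_coe.1 ha)
  obtain ⟨hbQ, hr⟩ := Finset.mem_filter.1 (Finset.mem_coe.1 hb)
  by_contra hab
  simp only [Prod.le_def, not_or] at hab
  rcases lt_or_ge a.1 b.1 with h1 | h1
  · have := nestingDepth_lt haQ h1 (by omega)
    omega
  · have := nestingDepth_lt (a := b) (b := a) hbQ (by omega) (by omega)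
    omega

theorem nestingDepth_pos {Q : Finset (ℕ × ℕ)} {a : ℕ × ℕ} (ha : a ∈ Q) :
    1 ≤ nestingDepth Q a :=
  finWidth_pos ⟨a, by simpa using ha⟩

theorem nestingDepth_le_finWidth_inter_posetPd {n d : ℕ} {Q : Finset (ℕ × ℕ)} {a : ℕ × ℕ}
    (hQ : Q ⊆ posetP n) (ha : a ∈ posetPd n d) :
    nestingDepth Q a ≤ finWidth (Q ∩ posetPd n d) := by
  refine finWidth_mono fun b hb => ?_
  obtain ⟨hbQ, hb1, hb2⟩ := Finset.mem_filter.1 hb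
  have := mem_posetPd.1 ha
  exact Finset.mem_inter.2 ⟨hbQ, mem_posetPd.2 ⟨hQ hbQ, by omega, by omega⟩⟩

/-- `X_{𝐦,0}` coincides with the FFLV polytope `X_𝐦`: a nonnegative point satisfies
all subset inequalities with `M = 0` iff it satisfies all the single-chain
inequalities `Σ_{α ∈ C} x_α ≤ m_{s(C)} + … + m_{f(C)-1}`. -/
theorem statement5 (n : ℕ) (hn : 2 ≤ n) (m : ℕ → ℕ)
    (x : ℕ × ℕ → ℝ) (hx : ∀ α ∈ posetP n, 0 ≤ x α) :
    (∀ P' ⊆ posetP n,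
        ∑ α ∈ P', x α ≤
          ∑ d ∈ Finset.Icc 1 (n - 1), (m d : ℝ) * (finWidth (P' ∩ posetPd n d) : ℝ))
      ↔
    (∀ C ⊆ posetP n, C.Nonempty → IsChain (· ≤ ·) ((C : Set (ℕ × ℕ))) →
      ∑ α ∈ C, x α ≤ ∑ d ∈ Finset.Ico (chainS C) (chainF C), (m d : ℝ)) := by
  constructor
  · intro h C hCP hne hC
    refine (h C hCP).trans ?_
    have hterm : ∀ d ∈ Finset.Icc 1 (n - 1),
        (m d : ℝ) * (finWidth (C ∩ posetPd n d) : ℝ) ≤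
          if d ∈ Finset.Ico (chainS C) (chainF C) then (m d : ℝ) else 0 := by
      intro d _
      rcases (C ∩ posetPd n d).eq_empty_or_nonempty with he | ⟨a, ha⟩
      · rw [he, finWidth_empty, Nat.cast_zero, mul_zero]
        positivity
      · obtain ⟨haC, had⟩ := Finset.mem_inter.1 ha
        have hmem : d ∈ Finset.Ico (chainS C) (chainF C) := by
          have := chainS_le haC
          have := le_chainF haC
          have := mem_posetPd.1 had
          rw [Finset.mem_Ico]
          omega
        rw [if_pos hmem]
        refine mul_le_of_le_one_right (by positivity) ?_
        exact_mod_cast finWidth_le_one_of_isChain (hC.mono (by simp))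
    refine (Finset.sum_le_sum hterm).trans ?_
    rw [← Finset.sum_filter]
    refine Finset.sum_le_sum_of_subset_of_nonneg ?_ (fun _ _ _ => by positivity)
    intro d hd
    exact (Finset.mem_filter.1 hd).2
  · intro h Q hQ
    rw [← Finset.sum_fiberwise_of_maps_to
      (fun a ha => Finset.mem_image_of_mem (nestingDepth Q) ha)]
    refine (Finset.sum_le_sum fun r _ => sum_chain_le_sum_filter_inter_nonempty h _
      ((Finset.filter_subset _ _).trans hQ) (isChain_nestingDepth_eq Q r)).trans ?_
    simp_rw [Finset.sum_filter]
    rw [Finset.sum_comm]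
    refine Finset.sum_le_sum fun d _ => ?_
    rw [← Finset.sum_filter, Finset.sum_const, nsmul_eq_mul, mul_comm]
    refine mul_le_mul_of_nonneg_left ?_ (by positivity)
    rw [Nat.cast_le, ← Nat.add_sub_cancel (finWidth (Q ∩ posetPd n d)) 1, ← Nat.card_Icc]
    refine Finset.card_le_card fun r hr => ?_
    obtain ⟨a, ha⟩ := (Finset.mem_filter.1 hr).2
    obtain ⟨har, had⟩ := Finset.mem_inter.1 ha
    obtain ⟨haQ, rfl⟩ := Finset.mem_filter.1 har
    exact Finset.mem_Icc.2
      ⟨nestingDepth_pos haQ, nestingDepth_le_finWidth_inter_posetPd hQ had⟩
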